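/- arXiv:2107.02318 — 6 statements merged into one kernel-verified Lean document; each statement's English description precedes it below -/
import Mathlib

section
/- For every binary merge tree T with n leaves, ∑_u min(R(c₁(u)), R(c₂(u))) ≤ 4n, where the sum ranges over all internal nodes u of T and c₁(u), c₂(u) denote the two children of u. -/
/-- A binary merge tree: every internal node has exactly two children. -/
inductive MergeTree : Type
  | leaf : MergeTree
  | node : MergeTree → MergeTree → MergeTree

namespace MergeTree

/-- The number of leaves of a binary merge tree. -/
def size : MergeTree → ℕ
  | leaf => 1
  | node l r => size l + size r

/-- The combination rank. -/
def rank : MergeTree → ℕ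
  | leaf => 0
  | node l r => if rank l = rank r then rank l + 1 else max (rank l) (rank r)

/-- The sum, over all internal nodes `u`, of the minimum of the combination ranks of
the two children of `u`. -/
def minRankSum : MergeTree → ℕ
  | leaf => 0
  | node l r => min (rank l) (rank r) + minRankSum l + minRankSum r

end MergeTree

theorem MergeTree.minRankSum_add_rank_lt_size (T : MergeTree) :
    T.minRankSum + T.rank < T.size := by
  induction T with
  | leaf => simp [minRankSum, rank, size]
  | node l r ihl ihr =>
    simp only [minRankSum, rank, size]
    split <;> omega

/-- Lemma 5 of the paper: for every binary merge tree with `n` leaves, the sum over all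
internal nodes of the minimum combination rank of the two children is at most `4n`. -/
theorem minRankSum_le (T : MergeTree) (n : ℕ) (hn : T.size = n) :
    T.minRankSum ≤ 4 * n := by
  have := T.minRankSum_add_rank_lt_size
  omega
end

section
/- For every binary merge tree T with n leaves, ∑_u min(log₂ size(c₁(u)), log₂ size(c₂(u))) ≤ 4n, where the sum ranges over all internal nodes u of T and c₁(u), c₂(u) denote the two children of u. -/
namespace MergeTree

/-- The sum, over all internal nodes `u`, of `min(log₂ size(c₁(u)), log₂ size(c₂(u)))`,
where `c₁(u), c₂(u)` are the two children of `u`. -/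
noncomputable def minLogSizeSum : MergeTree → ℝ
  | leaf => 0
  | node l r =>
      min (Real.logb 2 (size l)) (Real.logb 2 (size r)) + minLogSizeSum l + minLogSizeSum r

end MergeTree

namespace MergeTree

lemma size_pos : ∀ T : MergeTree, 0 < T.size
  | leaf => Nat.one_pos
  | node l _ => Nat.add_pos_left l.size_pos _

end MergeTree

lemma min_logb_two_add_logb_add_le {x y : ℝ} (hx : 0 < x) (hy : 0 < y) :
    min (Real.logb 2 x) (Real.logb 2 y) + Real.logb 2 (x + y) ≤
      1 + Real.logb 2 x + Real.logb 2 y := by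
  wlog hxy : x ≤ y generalizing x y
  · have := this hy hx (le_of_not_ge hxy)
    rw [min_comm, add_comm y x] at this
    linarith
  have hsum : Real.logb 2 (x + y) ≤ Real.logb 2 (2 * y) :=
    Real.logb_le_logb_of_le one_lt_two (by positivity) (by linarith)
  rw [Real.logb_mul two_ne_zero hy.ne', Real.logb_self_eq_one one_lt_two] at hsum
  linarith [min_le_left (Real.logb 2 x) (Real.logb 2 y)]

namespace MergeTree

lemma minLogSizeSum_add_logb_size_add_one_le (T : MergeTree) :
    T.minLogSizeSum + Real.logb 2 T.size + 1 ≤ T.size := by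
  induction T with
  | leaf => simp [minLogSizeSum, size]
  | node l r ihl ihr =>
    have h := min_logb_two_add_logb_add_le (Nat.cast_pos.2 l.size_pos) (Nat.cast_pos.2 r.size_pos)
    simp only [minLogSizeSum, size, Nat.cast_add]
    linarith

end MergeTree

/-- Equation (4) of the paper: for every binary merge tree with `n` leaves, the sum over
all internal nodes of the logarithm of the number of leaves of the smaller child is at
most `4n`. -/
theorem minLogSizeSum_le (T : MergeTree) (n : ℕ) (hn : T.size = n) :
    T.minLogSizeSum ≤ 4 * n := by
  subst hn
  have hlog : 0 ≤ Real.logb 2 T.size :=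
    Real.logb_nonneg one_lt_two (Nat.one_le_cast.2 T.size_pos)
  have hsize : (0 : ℝ) ≤ T.size := Nat.cast_nonneg _
  linarith [T.minLogSizeSum_add_logb_size_add_one_le]
end

section
/- There exists a constant C > 0 such that the following holds for every n and every binary merge tree T with n leaves. For each internal node u of T, let σ(u) denote a child of u of minimum combination rank (either one if the two ranks are equal). Then ∑_u log₂ size(σ(u)) ≤ C·n, where the sum ranges over all internal nodes u of T. -/
namespace MergeTree

/-- Given a selector `sel` that at each internal node `node l r` picks one child
(`true` = left, `false` = right), the sum over all internal nodes `u` of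
`log₂ size(σ(u))` where `σ(u)` is the selected child of `u`. -/
noncomputable def selLogSum (sel : MergeTree → MergeTree → Bool) : MergeTree → ℝ
  | leaf => 0
  | node l r =>
      Real.logb 2 (size (if sel l r then l else r)) + selLogSum sel l + selLogSum sel r

end MergeTree

namespace MergeTree

theorem two_pow_rank_le_size (T : MergeTree) : 2 ^ T.rank ≤ T.size := by
  induction T with
  | leaf => simp [rank, size]
  | node l r ihl ihr =>
    simp only [rank, size]
    split_ifs with h
    · rw [← h] at ihr
      rw [pow_succ]
      lia
    · rcases max_choice (rank l) (rank r) with h | h <;> rw [h] <;> lia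

theorem logb_two_le_of_two_pow_le {s : ℝ} {k : ℕ} (hs : 2 ^ k ≤ s) :
    Real.logb 2 s ≤ s * ((k + 2) / 2 ^ k) := by
  have hk : (0 : ℝ) < 2 ^ k := by positivity
  obtain ⟨t, rfl⟩ : ∃ t, s = 2 ^ k * t := ⟨s / 2 ^ k, by field_simp⟩
  have ht : 1 ≤ t := by nlinarith
  have hlog : Real.logb 2 t ≤ 2 * t := by
    have h2 := Real.log_two_gt_d9
    rw [Real.logb, div_le_iff₀ (by linarith)]
    nlinarith [Real.log_le_sub_one_of_pos (by linarith : 0 < t)]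
  rw [Real.logb_mul hk.ne' (by linarith), Real.logb_pow, Real.logb_self_eq_one one_lt_two]
  have : 2 ^ k * t * ((k + 2) / 2 ^ k) = t * (k + 2) := by field_simp
  rw [this]
  nlinarith [(Nat.cast_nonneg k : (0 : ℝ) ≤ k)]

/-- The partial sum `∑ k < r, (k + 2) / 2 ^ k` in closed form. -/
noncomputable def rankWeight (r : ℕ) : ℝ := 6 - (2 * r + 6) / 2 ^ r

theorem rankWeight_succ (r : ℕ) : rankWeight (r + 1) = rankWeight r + (r + 2) / 2 ^ r := by
  simp only [rankWeight, pow_succ, Nat.cast_add, Nat.cast_one]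
  field_simp
  ring

theorem rankWeight_mono : Monotone rankWeight :=
  monotone_nat_of_le_succ fun r => by
    rw [rankWeight_succ]
    exact le_add_of_nonneg_right (by positivity)

theorem rankWeight_le (r : ℕ) : rankWeight r ≤ 6 :=
  sub_le_self _ (by positivity)

theorem rank_left_le_rank_node (l r : MergeTree) : l.rank ≤ (node l r).rank := by
  simp only [rank]
  split_ifs <;> lia

theorem rank_right_le_rank_node (l r : MergeTree) : r.rank ≤ (node l r).rank := by
  simp only [rank]
  split_ifs <;> lia

theorem logb_size_add_le {T : MergeTree} {x : ℝ} {k : ℕ}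
    (hx : x ≤ T.size * rankWeight T.rank) (hk : T.rank < k) :
    Real.logb 2 T.size + x ≤ T.size * rankWeight k := by
  have hlog := logb_two_le_of_two_pow_le (s := T.size) (k := T.rank)
    (by exact_mod_cast two_pow_rank_le_size T)
  calc Real.logb 2 T.size + x ≤ T.size * rankWeight (T.rank + 1) := by
        rw [rankWeight_succ]
        linarith
    _ ≤ T.size * rankWeight k := by
        gcongr
        exact rankWeight_mono hk

theorem selLogSum_le_size_mul_rankWeight (sel : MergeTree → MergeTree → Bool)
    (hsel : ∀ l r : MergeTree,
      rank (if sel l r then l else r) ≤ rank (if sel l r then r else l)) (T : MergeTree) :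
    T.selLogSum sel ≤ T.size * rankWeight T.rank := by
  induction T with
  | leaf => simp [selLogSum, rankWeight, rank]
  | node l r ihl ihr =>
    have hmin := hsel l r
    simp only [selLogSum]
    have hsize : ((node l r).size : ℝ) = l.size + r.size := by simp [size]
    rw [hsize, add_mul]
    cases h : sel l r <;> simp only [h, if_true, if_false, Bool.false_eq_true] at hmin ⊢
    · have hlt : r.rank < (node l r).rank := by
        simp only [rank]
        split_ifs <;> lia
      have hr := logb_size_add_le ihr hlt
      have hl : l.size * rankWeight l.rank ≤ l.size * rankWeight (node l r).rank := by
        gcongr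
        exact rankWeight_mono (rank_left_le_rank_node l r)
      linarith
    · have hlt : l.rank < (node l r).rank := by
        simp only [rank]
        split_ifs <;> lia
      have hl := logb_size_add_le ihl hlt
      have hr : r.size * rankWeight r.rank ≤ r.size * rankWeight (node l r).rank := by
        gcongr
        exact rankWeight_mono (rank_right_le_rank_node l r)
      linarith

end MergeTree

/-- Lemma 8 of the paper: there is a universal constant `C > 0` such that for any binary
merge tree `T` with `n` leaves and any selection `σ(u)` of a minimum-rank child at each
internal node `u` (either one if the ranks are equal), `∑_u log₂ size(σ(u)) ≤ C·n`. -/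
theorem selLogSum_le : ∃ C : ℝ, 0 < C ∧
    ∀ (n : ℕ) (T : MergeTree), T.size = n →
      ∀ sel : MergeTree → MergeTree → Bool,
        (∀ l r : MergeTree,
          MergeTree.rank (if sel l r then l else r) ≤ MergeTree.rank (if sel l r then r else l)) →
        T.selLogSum sel ≤ C * n := by
  refine ⟨6, by norm_num, ?_⟩
  rintro n T rfl sel hsel
  calc T.selLogSum sel ≤ T.size * MergeTree.rankWeight T.rank :=
        MergeTree.selLogSum_le_size_mul_rankWeight sel hsel T
    _ ≤ T.size * 6 := by
        gcongr
        exact MergeTree.rankWeight_le _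
    _ = 6 * T.size := mul_comm _ _
end

section
/- Let T be a finite rooted tree in which every vertex has at most m children, let k ≥ 2 and let D ≥ 1 be integers. Then the number of subtrees S of T with the following properties is at most (m^k + 1)^{k^D}: (i) S contains the root of T; (ii) every vertex of S has either 0 or exactly k of its T-children in S (and its S-children are among its T-children); (iii) every vertex of S is at depth at most D in T. -/
/-- A finite set of paths from the root (lists of child indices) that contains the root, is closed
under taking the parent, in which every vertex has `0` or exactly `k` children, and whose vertices
have depth at most `D`. -/
structure IsKarySubtree {m : ℕ} (k D : ℕ) (S : Finset (List (Fin m))) : Prop where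
  root_mem : [] ∈ S
  parent_mem : ∀ (p : List (Fin m)) (i : Fin m), p ++ [i] ∈ S → p ∈ S
  arity : ∀ p ∈ S, (Finset.univ.filter fun i : Fin m => p ++ [i] ∈ S).card = 0 ∨
    (Finset.univ.filter fun i : Fin m => p ++ [i] ∈ S).card = k
  depth_le : ∀ p ∈ S, p.length ≤ D

/-- The tree whose root has the children `c j`, with the tree `A j` hanging below `c j`. -/
def graft {m k : ℕ} (x : (Fin k → Fin m) × (Fin k → Finset (List (Fin m)))) :
    Finset (List (Fin m)) :=
  insert [] (Finset.univ.biUnion fun j => (x.2 j).image (List.cons (x.1 j)))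

/-- A finite family containing all `k`-ary subtrees of depth at most `D`. -/
def karyFamily (m k : ℕ) : ℕ → Finset (Finset (List (Fin m)))
  | 0 => {{[]}}
  | D + 1 => insert {[]} ((Finset.univ ×ˢ
      Fintype.piFinset fun _ : Fin k => karyFamily m k D).image graft)

/-- The part of `S` below the child `c` of the root. -/
noncomputable def branch {m : ℕ} (S : Finset (List (Fin m))) (c : Fin m) : Finset (List (Fin m)) :=
  S.preimage (List.cons c) (List.cons_injective.injOn)

theorem mem_branch {m : ℕ} {S : Finset (List (Fin m))} {c : Fin m} {p : List (Fin m)} :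
    p ∈ branch S c ↔ c :: p ∈ S := by
  simp [branch]

namespace IsKarySubtree

variable {m k D : ℕ} {S : Finset (List (Fin m))}

theorem mem_of_append_mem (h : IsKarySubtree k D S) (p q : List (Fin m)) (hpq : p ++ q ∈ S) :
    p ∈ S := by
  induction q using List.reverseRecOn with
  | nil => simpa using hpq
  | append_singleton q i ih =>
    exact ih (h.parent_mem _ i (by simpa using hpq))

theorem singleton_mem (h : IsKarySubtree k D S) {c : Fin m} {p : List (Fin m)}
    (hp : c :: p ∈ S) : [c] ∈ S :=
  h.mem_of_append_mem [c] p hp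

theorem branch (h : IsKarySubtree k (D + 1) S) {c : Fin m} (hc : [c] ∈ S) :
    IsKarySubtree k D (branch S c) where
  root_mem := mem_branch.2 hc
  parent_mem p i hp := mem_branch.2 (h.parent_mem (c :: p) i (mem_branch.1 hp))
  arity p hp := by
    simpa only [mem_branch, List.cons_append] using h.arity (c :: p) (mem_branch.1 hp)
  depth_le p hp := by
    simpa using h.depth_le _ (mem_branch.1 hp)

theorem eq_singleton_nil (h : IsKarySubtree k D S) (hS : ∀ c : Fin m, [c] ∉ S) : S = {[]} := by
  ext p
  cases p with
  | nil => simp [h.root_mem]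
  | cons c p =>
    simp only [Finset.mem_singleton, reduceCtorEq, iff_false]
    exact fun hp => hS c (h.singleton_mem hp)

theorem mem_karyFamily (h : IsKarySubtree k D S) : S ∈ karyFamily m k D := by
  induction D generalizing S with
  | zero =>
    rw [karyFamily, Finset.mem_singleton]
    exact h.eq_singleton_nil fun c hc => by simpa using h.depth_le _ hc
  | succ D ih =>
    rw [karyFamily, Finset.mem_insert]
    rcases h.arity [] h.root_mem with h0 | hk
    · left
      refine h.eq_singleton_nil fun c hc => ?_
      rw [Finset.card_eq_zero] at h0
      exact Finset.notMem_empty c (h0 ▸ by simpa using hc)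
    · right
      set C := Finset.univ.filter fun i : Fin m => [] ++ [i] ∈ S with hC
      have mem_C : ∀ c, c ∈ C ↔ [c] ∈ S := by simp [hC]
      refine Finset.mem_image.2 ⟨(C.orderEmbOfFin hk,
        fun j => _root_.branch S (C.orderEmbOfFin hk j)), ?_, ?_⟩
      · simp only [Finset.mem_product, Finset.mem_univ, true_and, Fintype.mem_piFinset]
        exact fun j => ih (h.branch ((mem_C _).1 (C.orderEmbOfFin_mem hk j)))
      · ext p
        cases p with
        | nil => simp [graft, h.root_mem]
        | cons c p =>
          simp only [graft, Finset.mem_insert, reduceCtorEq, false_or, Finset.mem_biUnion,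
            Finset.mem_univ, true_and, Finset.mem_image, mem_branch, List.cons.injEq]
          constructor
          · rintro ⟨j, q, hq, rfl, rfl⟩
            exact hq
          · intro hp
            have hc : c ∈ Set.range (C.orderEmbOfFin hk) := by
              rw [Finset.range_orderEmbOfFin]
              exact (mem_C c).2 (h.singleton_mem hp)
            obtain ⟨j, rfl⟩ := hc
            exact ⟨j, p, hp, rfl, rfl⟩

end IsKarySubtree

theorem card_karyFamily_succ_le (m k D : ℕ) :
    (karyFamily m k (D + 1)).card ≤ m ^ k * (karyFamily m k D).card ^ k + 1 := by
  rw [karyFamily]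
  refine (Finset.card_insert_le _ _).trans (Nat.add_le_add_right ?_ 1)
  refine Finset.card_image_le.trans_eq ?_
  simp [Finset.card_product]

theorem card_karyFamily_pos (m k D : ℕ) : 0 < (karyFamily m k D).card := by
  rw [Finset.card_pos]
  cases D <;> simp [karyFamily]

theorem card_karyFamily_mul_le (m k D : ℕ) (hk : 2 ≤ k) :
    (karyFamily m k D).card * (m ^ k + 1) ≤ (m ^ k + 1) ^ k ^ D := by
  induction D with
  | zero => simp [karyFamily]
  | succ D ih =>
    have hpos : 1 ≤ (karyFamily m k D).card ^ k := Nat.pow_pos (card_karyFamily_pos m k D)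
    calc (karyFamily m k (D + 1)).card * (m ^ k + 1)
        ≤ (m ^ k * (karyFamily m k D).card ^ k + (karyFamily m k D).card ^ k) * (m ^ k + 1) := by
          gcongr
          exact (card_karyFamily_succ_le m k D).trans (by gcongr)
      _ = (karyFamily m k D).card ^ k * (m ^ k + 1) ^ 2 := by ring
      _ ≤ (karyFamily m k D).card ^ k * (m ^ k + 1) ^ k := by
          gcongr
          exact Nat.le_add_left 1 _
      _ = ((karyFamily m k D).card * (m ^ k + 1)) ^ k := (mul_pow _ _ _).symm
      _ ≤ ((m ^ k + 1) ^ k ^ D) ^ k := by gcongr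
      _ = (m ^ k + 1) ^ k ^ (D + 1) := by rw [← pow_mul, pow_succ]


/-- Counting `k`-ary depth-`D` subtrees of a rooted tree with arity at most `m`.

A finite rooted tree in which every vertex has at most `m` children is represented as a
finite, prefix-closed set `T` of paths from the root (lists of child-indices in `Fin m`)
containing the empty path (the root). A subtree `S` in the sense of the statement is a
subset of `T` containing the root, closed under taking the parent, in which every vertex
has either 0 or exactly `k` of its children, and all of whose vertices are at depth at
most `D`. The number of such subtrees is at most `(m^k + 1)^(k^D)`. -/
theorem count_kary_subtrees (m k D : ℕ) (hk : 2 ≤ k) (hD : 1 ≤ D)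
    (T : Finset (List (Fin m)))
    (hroot : ([] : List (Fin m)) ∈ T)
    (hclosed : ∀ (p : List (Fin m)) (i : Fin m), p ++ [i] ∈ T → p ∈ T) :
    {S : Finset (List (Fin m)) | ([] : List (Fin m)) ∈ S ∧ S ⊆ T ∧
        (∀ (p : List (Fin m)) (i : Fin m), p ++ [i] ∈ S → p ∈ S) ∧
        (∀ p ∈ S, (Finset.univ.filter fun i : Fin m => p ++ [i] ∈ S).card = 0 ∨
            (Finset.univ.filter fun i : Fin m => p ++ [i] ∈ S).card = k) ∧
        (∀ p ∈ S, p.length ≤ D)}.ncard ≤ (m ^ k + 1) ^ k ^ D := by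
  refine le_trans ?_ ((Nat.le_mul_of_pos_right _ (Nat.succ_pos _)).trans
    (card_karyFamily_mul_le m k D hk))
  rw [← Set.ncard_coe_finset]
  refine Set.ncard_le_ncard ?_ (Finset.finite_toSet _)
  rintro S ⟨hr, -, hp, ha, hd⟩
  exact IsKarySubtree.mem_karyFamily ⟨hr, hp, ha, hd⟩
end

section
/- Let T be a finite rooted tree with N ≥ 2 vertices in which every internal vertex has exactly two children. Consider the random root-to-leaf descent that starts at the root and, at each internal vertex, moves to one of its two children chosen uniformly and independently at random, stopping upon reaching a leaf. Then for every natural number k, the probability that the descent takes more than 4·k·log₂ N steps (i.e., that the leaf reached has depth greater than 4·k·log₂ N) is at most 2^{−k}. -/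
namespace MergeTree

/-- The total number of vertices of a binary merge tree. -/
def numVertices : MergeTree → ℕ
  | leaf => 1
  | node l r => 1 + numVertices l + numVertices r

/-- `probDepthGT T c` is the probability that the uniform random root-to-leaf descent in
`T` (at each internal node move to a uniformly random child) reaches a leaf at depth
strictly greater than `c`. -/
noncomputable def probDepthGT : MergeTree → ℝ → ℝ
  | leaf, c => if (0 : ℝ) > c then 1 else 0
  | node l r, c => (probDepthGT l (c - 1) + probDepthGT r (c - 1)) / 2

end MergeTree

namespace MergeTree

theorem probDepthGT_le_one (T : MergeTree) (c : ℝ) : T.probDepthGT c ≤ 1 := by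
  induction T generalizing c with
  | leaf => unfold probDepthGT; split_ifs <;> norm_num
  | node l r ihl ihr =>
    unfold probDepthGT
    linarith [ihl (c - 1), ihr (c - 1)]

/-- Markov's inequality for `2 ^ depth`, whose expectation is the number of leaves. -/
theorem probDepthGT_le_numVertices_mul_rpow (T : MergeTree) (c : ℝ) :
    T.probDepthGT c ≤ T.numVertices * (2 : ℝ) ^ (-c) := by
  induction T generalizing c with
  | leaf =>
    simp only [probDepthGT, numVertices, Nat.cast_one, one_mul]
    split_ifs with h
    · exact Real.one_le_rpow (by norm_num) (by linarith)
    · positivity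
  | node l r ihl ihr =>
    have hstep : (2 : ℝ) ^ (-(c - 1)) = 2 * 2 ^ (-c) := by
      rw [neg_sub, sub_eq_add_neg, Real.rpow_add two_pos, Real.rpow_one]
    have hl := ihl (c - 1)
    have hr := ihr (c - 1)
    rw [hstep] at hl hr
    have hpos : (0 : ℝ) < 2 ^ (-c) := by positivity
    simp only [probDepthGT, numVertices]
    push_cast
    linarith

end MergeTree

/-- Lemma 7 of the paper: in a finite rooted binary tree with `N ≥ 2` vertices in which
every internal vertex has exactly two children, the uniform random root-to-leaf descent
takes more than `4·k·log₂ N` steps with probability at most `2^{-k}`. -/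
theorem random_descent_depth (T : MergeTree) (N : ℕ) (hN : T.numVertices = N)
    (h2 : 2 ≤ N) (k : ℕ) :
    T.probDepthGT (4 * k * Real.logb 2 N) ≤ (1 / 2 : ℝ) ^ k := by
  have hN2 : (2 : ℝ) ≤ N := by exact_mod_cast h2
  have hN0 : (0 : ℝ) < N := by linarith
  rcases Nat.eq_zero_or_pos k with rfl | hk
  · simpa using T.probDepthGT_le_one _
  have hpow : (2 : ℝ) ^ (-(4 * k * Real.logb 2 N)) = ((N : ℝ) ^ (4 * k))⁻¹ := by
    rw [Real.rpow_neg zero_le_two, mul_comm, Real.rpow_mul zero_le_two,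
      Real.rpow_logb two_pos (by norm_num) hN0]
    exact_mod_cast congrArg _ (Real.rpow_natCast (N : ℝ) (4 * k))
  have h := T.probDepthGT_le_numVertices_mul_rpow (4 * k * Real.logb 2 N)
  rw [hN, hpow] at h
  refine h.trans ?_
  rw [one_div, inv_pow, ← div_eq_mul_inv, div_le_iff₀ (by positivity), ← div_eq_inv_mul,
    le_div_iff₀ (by positivity)]
  calc (N : ℝ) * 2 ^ k ≤ N * N ^ k := by gcongr
    _ = (N : ℝ) ^ (k + 1) := by ring
    _ ≤ (N : ℝ) ^ (4 * k) := pow_le_pow_right₀ (by linarith) (by omega)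
end

section
/- Let e₁, …, e_m be a sequence of edges (unordered pairs of vertices, possibly with repetitions) on a finite vertex set, and suppose there exists a set Y ⊆ {1, …, m} with |Y| ≤ s such that the multigraph with edge multiset {e_t : t ∉ Y} is a pseudoforest, i.e., every connected component contains at most as many edges (counted with multiplicity) as vertices. Call e_t bad if the two endpoints of e_t already lie in the same connected component of the multigraph with edges {e₁, …, e_{t−1}}, and call e_t super bad if e_t is bad and the connected component of the multigraph with edges {e₁, …, e_{t−1}} containing the endpoints of e_t already contains some bad edge e_{t'} with t' < t. Then the number of super bad edges among e₁, …, e_m is at most s. -/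
/-- `connE e t a b`: vertices `a` and `b` are connected in the multigraph consisting of
the edges `e s` for indices `s < t`. -/
def connE {V : Type*} {m : ℕ} (e : Fin m → V × V) (t : ℕ) : V → V → Prop :=
  Relation.ReflTransGen fun a b =>
    ∃ s : Fin m, (s : ℕ) < t ∧ (e s = (a, b) ∨ e s = (b, a))

/-- `connExcl e Y a b`: vertices `a` and `b` are connected in the multigraph consisting
of the edges `e s` for indices `s ∉ Y`. -/
def connExcl {V : Type*} {m : ℕ} (e : Fin m → V × V) (Y : Finset (Fin m)) :
    V → V → Prop :=
  Relation.ReflTransGen fun a b =>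
    ∃ s : Fin m, s ∉ Y ∧ (e s = (a, b) ∨ e s = (b, a))

/-- An edge `e t` is *bad* if its two endpoints already lie in the same connected
component of the multigraph formed by the earlier edges `e s`, `s < t`. -/
def IsBadEdge {V : Type*} {m : ℕ} (e : Fin m → V × V) (t : Fin m) : Prop :=
  connE e (t : ℕ) (e t).1 (e t).2

/-- An edge `e t` is *super bad* if it is bad and the connected component of the
multigraph of earlier edges containing its endpoints already contains a bad edge
`e t'` with `t' < t`. -/
def IsSuperBadEdge {V : Type*} {m : ℕ} (e : Fin m → V × V) (t : Fin m) : Prop :=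
  IsBadEdge e t ∧ ∃ t' : Fin m, t' < t ∧ IsBadEdge e t' ∧ connE e (t : ℕ) (e t').1 (e t).1

/-- The cardinality of a set is the sum of its fibre cardinalities over the classes of a setoid. -/
theorem ncard_eq_sum_ncard_class {V L : Type*} [Finite L] (r : Setoid V)
    [Fintype (Quotient r)] (p : L → V) (S : Set L) :
    S.ncard = ∑ q : Quotient r, {l | l ∈ S ∧ Quotient.mk r (p l) = q}.ncard := by
  classical
  have := Fintype.ofFinite L
  rw [Set.ncard_eq_toFinset_card', Finset.card_eq_sum_card_fiberwise (t := Finset.univ)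
    (f := fun l => Quotient.mk r (p l)) (by intro x _; simp)]
  refine Finset.sum_congr rfl fun q _ => ?_
  rw [Set.ncard_eq_toFinset_card']
  congr 1
  ext l
  simp

/-- Cardinalities may be compared class by class along an equivalence relation. -/
theorem ncard_le_ncard_of_forall_class {V J K : Type*} [Finite V] [Finite J] [Finite K]
    (r : Setoid V) (f : J → V) (g : K → V) (A : Set J) (B : Set K)
    (h : ∀ c, {j | j ∈ A ∧ r (f j) c}.ncard ≤ {k | k ∈ B ∧ r (g k) c}.ncard) :
    A.ncard ≤ B.ncard := by
  have := Fintype.ofFinite (Quotient r)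
  rw [ncard_eq_sum_ncard_class r f A, ncard_eq_sum_ncard_class r g B]
  refine Finset.sum_le_sum fun q _ => ?_
  induction q using Quotient.inductionOn with
  | h c => simpa only [Quotient.eq] using h c

/-- The reflexive transitive closure of a symmetric relation is symmetric. -/
theorem reflTransGen_symm {α : Type*} {r : α → α → Prop} (hr : ∀ a b, r a b → r b a) {a b : α}
    (h : Relation.ReflTransGen r a b) : Relation.ReflTransGen r b a := by
  induction h with
  | refl => exact .refl
  | tail _ hbc ih => exact .head (hr _ _ hbc) ih

section Connectivity

variable {V : Type*} {m : ℕ} {e : Fin m → V × V}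

theorem connE_symm {t : ℕ} {a b : V} (h : connE e t a b) : connE e t b a :=
  reflTransGen_symm (fun _ _ ⟨s, hs, hab⟩ => ⟨s, hs, hab.symm⟩) h

theorem connExcl_symm {Y : Finset (Fin m)} {a b : V} (h : connExcl e Y a b) :
    connExcl e Y b a :=
  reflTransGen_symm (fun _ _ ⟨s, hs, hab⟩ => ⟨s, hs, hab.symm⟩) h

theorem connE_mono {t u : ℕ} (htu : t ≤ u) {a b : V} (h : connE e t a b) : connE e u a b :=
  Relation.ReflTransGen.mono (fun _ _ ⟨s, hs, hab⟩ => ⟨s, hs.trans_le htu, hab⟩) _ _ h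

theorem connE_edge {t : ℕ} {j : Fin m} (hj : (j : ℕ) < t) : connE e t (e j).1 (e j).2 :=
  .single ⟨j, hj, .inl rfl⟩

theorem connE_of_connExcl {Y : Finset (Fin m)} {a b : V} (h : connExcl e Y a b) :
    connE e m a b :=
  Relation.ReflTransGen.mono (fun _ _ ⟨s, _, hab⟩ => ⟨s, s.isLt, hab⟩) _ _ h

variable (e) in
/-- Connectivity by the edges of index less than `t`, as a setoid. -/
def connESetoid (t : ℕ) : Setoid V where
  r := connE e t
  iseqv := ⟨fun _ => .refl, connE_symm, .trans⟩

variable (e) in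
/-- Connectivity by the edges of index outside `Y`, as a setoid. -/
def connExclSetoid (Y : Finset (Fin m)) : Setoid V where
  r := connExcl e Y
  iseqv := ⟨fun _ => .refl, connExcl_symm, .trans⟩

/-- A connection by the edges up to and including `e j` either avoids `e j` or passes between its
endpoints. -/
theorem connE_succ_cases {j : Fin m} {x c : V} (h : connE e (j + 1) x c) :
    connE e j x c ∨ (connE e j x (e j).1 ∧ connE e j (e j).2 c) ∨
      (connE e j x (e j).2 ∧ connE e j (e j).1 c) := by
  induction h with
  | refl => exact .inl .refl
  | @tail b c _ hbc ih =>
    obtain ⟨s, hs, hsbc⟩ := hbc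
    rcases Nat.lt_succ_iff_lt_or_eq.mp hs with hlt | heq
    · have hbc : connE e j b c := .single ⟨s, hlt, hsbc⟩
      rcases ih with h | ⟨h, h'⟩ | ⟨h, h'⟩
      · exact .inl (h.trans hbc)
      · exact .inr (.inl ⟨h, h'.trans hbc⟩)
      · exact .inr (.inr ⟨h, h'.trans hbc⟩)
    · obtain rfl : s = j := Fin.ext heq
      rcases hsbc with hsbc | hsbc <;> rw [hsbc] at ih ⊢ <;> dsimp only at ih ⊢
      · rcases ih with h | ⟨h, h'⟩ | ⟨h, h'⟩
        · exact .inr (.inl ⟨h, .refl⟩)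
        · exact .inr (.inl ⟨h, .refl⟩)
        · exact .inl h
      · rcases ih with h | ⟨h, h'⟩ | ⟨h, h'⟩
        · exact .inr (.inr ⟨h, .refl⟩)
        · exact .inl h
        · exact .inr (.inr ⟨h, .refl⟩)

/-- A component has at most one vertex more than it has edges that are not bad. -/
theorem ncard_component_le [Finite V] {t : ℕ} (ht : t ≤ m) (c : V) :
    {x | connE e t x c}.ncard ≤
      {j : Fin m | ((j : ℕ) < t ∧ ¬ IsBadEdge e j) ∧ connE e t (e j).1 c}.ncard + 1 := by
  induction t generalizing c with
  | zero =>
    have : {x | connE e 0 x c} ⊆ {c} := by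
      intro x hx
      rcases Relation.ReflTransGen.cases_head hx with h | ⟨_, ⟨s, hs, _⟩, _⟩
      · exact h
      · exact absurd hs (Nat.not_lt_zero _)
    have := Set.ncard_le_ncard this
    rw [Set.ncard_singleton] at this
    omega
  | succ t ih =>
    specialize ih (by omega)
    obtain ⟨k, rfl⟩ : ∃ k : Fin m, (k : ℕ) = t := ⟨⟨t, ht⟩, rfl⟩
    have mono {a b : V} : connE e k a b → connE e (k + 1) a b := connE_mono (Nat.le_succ _)
    by_cases hsub : {x | connE e (k + 1) x c} ⊆ {x | connE e k x c}
    · refine (Set.ncard_le_ncard hsub).trans ((ih c).trans ?_)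
      gcongr ?_ + 1
      exact Set.ncard_le_ncard fun j ⟨⟨hj, hb⟩, hc⟩ => ⟨⟨by omega, hb⟩, mono hc⟩
    · obtain ⟨y, hy, hyc⟩ := Set.not_subset.mp hsub
      have hedge : connE e (k + 1) (e k).1 (e k).2 := connE_edge (Nat.lt_succ_self _)
      have hnb : ¬ IsBadEdge e k := by
        intro hb
        rcases connE_succ_cases hy with h | ⟨h, h'⟩ | ⟨h, h'⟩
        · exact hyc h
        · exact hyc ((h.trans hb).trans h')
        · exact hyc ((h.trans (connE_symm hb)).trans h')
      have hends : connE e k (e k).1 c ∨ connE e k (e k).2 c := by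
        rcases connE_succ_cases hy with h | ⟨h, h'⟩ | ⟨h, h'⟩
        · exact absurd h hyc
        · exact .inr h'
        · exact .inl h'
      have h1 : connE e (k + 1) (e k).1 c :=
        hends.elim mono fun h => hedge.trans (mono h)
      have h2 : connE e (k + 1) (e k).2 c := (connE_symm hedge).trans h1
      have hV : {x | connE e (k + 1) x c} ⊆
          {x | connE e k x (e k).1} ∪ {x | connE e k x (e k).2} := by
        intro x hx
        rcases connE_succ_cases hx with h | ⟨h, _⟩ | ⟨h, _⟩
        · exact hends.imp (fun h' => h.trans (connE_symm h')) fun h' => h.trans (connE_symm h')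
        · exact .inl h
        · exact .inr h
      set N : V → Set (Fin m) :=
        fun v => {j | ((j : ℕ) < k ∧ ¬ IsBadEdge e j) ∧ connE e k (e j).1 v} with hN
      have hE : insert k (N (e k).1 ∪ N (e k).2) ⊆
          {j : Fin m | ((j : ℕ) < k + 1 ∧ ¬ IsBadEdge e j) ∧ connE e (k + 1) (e j).1 c} := by
        rintro j (rfl | ⟨⟨hj, hb⟩, hc⟩ | ⟨⟨hj, hb⟩, hc⟩)
        · exact ⟨⟨Nat.lt_succ_self _, hnb⟩, h1⟩
        · exact ⟨⟨by omega, hb⟩, (mono hc).trans h1⟩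
        · exact ⟨⟨by omega, hb⟩, (mono hc).trans h2⟩
      have hdisj : Disjoint (N (e k).1) (N (e k).2) :=
        Set.disjoint_left.mpr fun j hj hj' => hnb ((connE_symm hj.2).trans hj'.2)
      have hk : k ∉ N (e k).1 ∪ N (e k).2 := by
        rintro (h | h) <;> exact lt_irrefl _ h.1.1
      have hcardE := Set.ncard_le_ncard hE
      rw [Set.ncard_insert_of_notMem hk, Set.ncard_union_eq hdisj] at hcardE
      have hcardV := (Set.ncard_le_ncard hV).trans (Set.ncard_union_le _ _)
      have i1 : _ ≤ (N (e k).1).ncard + 1 := ih (e k).1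
      have i2 : _ ≤ (N (e k).2).ncard + 1 := ih (e k).2
      omega

/-- A component of the whole multigraph has at most as many edges outside `Y` as vertices, if
this holds for the components that remain after the removal of `Y`. -/
theorem ncard_edges_notMem_le [Finite V] {Y : Finset (Fin m)}
    (hpseudo : ∀ c : V,
      {j : Fin m | j ∉ Y ∧ connExcl e Y (e j).1 c}.ncard ≤ {x : V | connExcl e Y x c}.ncard)
    (c : V) :
    {j : Fin m | j ∉ Y ∧ connE e m (e j).1 c}.ncard ≤ {x | connE e m x c}.ncard := by
  refine ncard_le_ncard_of_forall_class (connExclSetoid e Y) (fun j => (e j).1) id _ _ fun d => ?_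
  by_cases hd : connE e m d c
  · refine (Set.ncard_le_ncard ?_).trans ((hpseudo d).trans (Set.ncard_le_ncard ?_))
    · exact fun j ⟨⟨hj, _⟩, hjd⟩ => ⟨hj, hjd⟩
    · exact fun x hx => ⟨(connE_of_connExcl hx).trans hd, hx⟩
  · refine (Set.ncard_le_ncard (t := ∅) ?_).trans (by simp)
    rintro j ⟨⟨_, hjc⟩, hjd⟩
    exact hd ((connE_symm (connE_of_connExcl hjd)).trans hjc)

/-- The first bad edge of a component is not super bad. -/
theorem ncard_superBad_le (c : V) :
    {j : Fin m | IsSuperBadEdge e j ∧ connE e m (e j).1 c}.ncard ≤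
      {j : Fin m | IsBadEdge e j ∧ connE e m (e j).1 c}.ncard - 1 := by
  set B := {j : Fin m | IsBadEdge e j ∧ connE e m (e j).1 c}
  have hsub : {j : Fin m | IsSuperBadEdge e j ∧ connE e m (e j).1 c} ⊆ B :=
    fun j ⟨hj, hc⟩ => ⟨hj.1, hc⟩
  rcases B.eq_empty_or_nonempty with hB | hB
  · rw [Set.subset_eq_empty hsub hB, Set.ncard_empty]
    exact Nat.zero_le _
  · obtain ⟨k, hk, hmin⟩ := Set.exists_min_image B id B.toFinite hB
    rw [← Set.ncard_sdiff_singleton_of_mem hk]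
    refine Set.ncard_le_ncard fun j hj => ⟨hsub hj, ?_⟩
    rintro rfl
    obtain ⟨⟨_, i, hij, hi, hconn⟩, hc⟩ := hj
    exact (hmin i ⟨hi, (connE_mono j.isLt.le hconn).trans hc⟩).not_gt hij

end Connectivity

/-- Footnote 4 of the paper: if removing a set `Y` of at most `s` of the edges leaves a
pseudoforest (every connected component of the remaining multigraph has at most as many
edges, counted with multiplicity, as vertices), then the number of super bad edges in
the whole sequence is at most `s`. -/
theorem superbad_edges_le_stash {V : Type*} [Fintype V] {m : ℕ}
    (e : Fin m → V × V) (s : ℕ) (Y : Finset (Fin m)) (hY : Y.card ≤ s)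
    (hpseudo : ∀ c : V,
      {j : Fin m | j ∉ Y ∧ connExcl e Y (e j).1 c}.ncard ≤
        {x : V | connExcl e Y x c}.ncard) :
    {t : Fin m | IsSuperBadEdge e t}.ncard ≤ s := by
  refine le_trans ?_ hY
  rw [← Set.ncard_coe_finset Y]
  refine ncard_le_ncard_of_forall_class (connESetoid e m) (fun j => (e j).1) (fun j => (e j).1)
    _ _ fun c => ?_
  change {j : Fin m | IsSuperBadEdge e j ∧ connE e m (e j).1 c}.ncard ≤
    {j : Fin m | j ∈ Y ∧ connE e m (e j).1 c}.ncard
  have hsuper := ncard_superBad_le (e := e) c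
  have htree := ncard_component_le (e := e) le_rfl c
  have hout := ncard_edges_notMem_le hpseudo c
  have split (P : Fin m → Prop) :
      {j : Fin m | P j ∧ connE e m (e j).1 c}.ncard +
        {j : Fin m | ¬ P j ∧ connE e m (e j).1 c}.ncard =
        {j : Fin m | connE e m (e j).1 c}.ncard := by
    rw [← Set.ncard_union_eq (Set.disjoint_left.mpr fun j hj hj' => hj'.1 hj.1)]
    congr 1
    ext j
    by_cases hP : P j <;> simp [hP]
  have hbad := split (IsBadEdge e)
  have hYsplit := split (· ∈ Y)
  simp only [Fin.is_lt, true_and] at htree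
  omega
end
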